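/- arXiv:math/0308271 — 2 statements merged into one kernel-verified Lean document; each statement's English description precedes it below -/
import Mathlib

section
/- Let k ≥ 1, let ξ be a Hermitian k×k complex matrix with eigenvalues λ_1, …, λ_k (with multiplicity), let c > 0, and let N be the number of indices j with |λ_j| ≥ c. Then |ξ − F_c(ξ)|₂² ≤ (tr_k(ξ⁴))^{1/2} · (N/k)^{1/2}. -/
open Matrix

/-- The normalized Hilbert–Schmidt norm `|x|₂ = (tr_k(x* x))^{1/2}`, where
`tr_k = Tr/k` is the normalized trace (the trace `x* x` has real nonnegative
trace, and we take its real part). -/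
noncomputable def norm2 {k : ℕ} (x : Matrix (Fin k) (Fin k) ℂ) : ℝ :=
  Real.sqrt (((xᴴ * x).trace).re / k)

/-- The truncation `F_c(ξ)` of a Hermitian matrix `ξ`, obtained by applying
`F_c(t) = max (-c) (min c t)` via the continuous functional calculus. -/
noncomputable def matTrunc {k : ℕ} (c : ℝ) {ξ : Matrix (Fin k) (Fin k) ℂ}
    (hξ : ξ.IsHermitian) : Matrix (Fin k) (Fin k) ℂ :=
  hξ.cfc fun t => max (-c) (min c t)

/-- The trace of `f(A)` is the sum of the values of `f` at the eigenvalues of `A`. -/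
lemma Matrix.IsHermitian.trace_cfc {n 𝕜 : Type*} [RCLike 𝕜] [Fintype n] [DecidableEq n]
    {A : Matrix n n 𝕜} (hA : A.IsHermitian) (f : ℝ → ℝ) :
    (cfc f A).trace = ∑ i, (f (hA.eigenvalues i) : 𝕜) := by
  rw [hA.cfc_eq, Matrix.IsHermitian.cfc, Unitary.conjStarAlgAut_apply, Matrix.trace_mul_comm,
    ← mul_assoc]
  simp [Matrix.trace]

/-- The residual of truncation at level `c` is dominated in square by `t ^ 2`, and vanishes
when `|t| < c`. -/
lemma sq_sub_trunc_le {c : ℝ} (hc : 0 < c) (t : ℝ) :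
    (t - max (-c) (min c t)) ^ 2 ≤ t ^ 2 * (if c ≤ |t| then 1 else 0) := by
  split_ifs with h
  · rcases max_cases (-c) (min c t) with h1 | h1 <;> rcases min_cases c t with h2 | h2 <;>
      nlinarith
  · obtain ⟨h1, h2⟩ := abs_lt.1 (not_le.1 h)
    simp [min_eq_right h2.le, max_eq_right h1.le]

/-- For a Hermitian `k × k` matrix `ξ` (`k ≥ 1`) with eigenvalues
`λ_j`, `c > 0`, and `N` the number of indices with `|λ_j| ≥ c`, one has
`|ξ − F_c(ξ)|₂² ≤ (tr_k(ξ⁴))^{1/2} · (N/k)^{1/2}`. -/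
theorem stmt1 (k : ℕ) (hk : 1 ≤ k) (ξ : Matrix (Fin k) (Fin k) ℂ)
    (hξ : ξ.IsHermitian) (c : ℝ) (hc : 0 < c) :
    norm2 (ξ - matTrunc c hξ) ^ 2
      ≤ Real.sqrt (((ξ ^ 4).trace).re / k) *
        Real.sqrt (({j : Fin k | c ≤ |hξ.eigenvalues j|}.ncard : ℝ) / k) := by
  have hcont (f : ℝ → ℝ) : ContinuousOn f (spectrum ℝ ξ) :=
    Matrix.finite_real_spectrum.continuousOn f
  have hsa : IsSelfAdjoint ξ := hξ
  have hsub : ξ - matTrunc c hξ = cfc (fun t : ℝ => t - max (-c) (min c t)) ξ := by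
    rw [cfc_sub _ _ ξ (hcont _) (hcont _), cfc_id' ℝ ξ, matTrunc, hξ.cfc_eq]
  have hsq : ((ξ - matTrunc c hξ)ᴴ * (ξ - matTrunc c hξ)).trace.re
      = ∑ i, (hξ.eigenvalues i - max (-c) (min c (hξ.eigenvalues i))) ^ 2 := by
    have hherm : (ξ - matTrunc c hξ)ᴴ = ξ - matTrunc c hξ := by
      rw [hsub]
      exact cfc_predicate (R := ℝ) _ ξ
    rw [hherm, ← sq, hsub, ← cfc_pow _ 2 ξ (hcont _), hξ.trace_cfc, Complex.re_sum]
    exact Finset.sum_congr rfl fun i _ => Complex.ofReal_re _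
  have hfour : (ξ ^ 4).trace.re = ∑ i, (hξ.eigenvalues i ^ 2) ^ 2 := by
    rw [← cfc_pow_id (R := ℝ) ξ 4, hξ.trace_cfc, Complex.re_sum]
    exact Finset.sum_congr rfl fun i _ => (Complex.ofReal_re _).trans (pow_mul _ 2 2)
  have hcard : ({j : Fin k | c ≤ |hξ.eigenvalues j|}.ncard : ℝ)
      = ∑ i, (if c ≤ |hξ.eigenvalues i| then (1 : ℝ) else 0) ^ 2 := by
    simp [Set.ncard_eq_toFinset_card']
  have hk0 : (0 : ℝ) ≤ k := k.cast_nonneg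
  rw [norm2, Real.sq_sqrt (by rw [hsq]; positivity), hsq, hfour, hcard, Real.sqrt_div' _ hk0,
    Real.sqrt_div' _ hk0, div_mul_div_comm, Real.mul_self_sqrt hk0]
  gcongr
  exact (Finset.sum_le_sum fun i _ => sq_sub_trunc_le hc _).trans
    (Real.sum_mul_le_sqrt_mul_sqrt _ _ _)
end

section
/- Let k ≥ 1, let ξ be a Hermitian k×k complex matrix, let R ≥ 1, γ > 0, and let m be a positive even integer. If tr_k(ξ^m) ≤ R^m + γ and tr_k(ξ⁴) ≤ R⁴ + γ, then |ξ − F_{R+γ}(ξ)|₂² ≤ (R⁴ + γ)^{1/2} · ((R^m + γ)/(R + γ)^m)^{1/2}. -/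
open Matrix

namespace Matrix.IsHermitian

variable {n : Type*} [Fintype n] [DecidableEq n] {A : Matrix n n ℂ}

/-- The trace of `f(A)` is the sum of `f` over the eigenvalues of `A`. -/
lemma re_trace_cfc (hA : A.IsHermitian) (f : ℝ → ℝ) :
    ((cfc f A).trace).re = ∑ i, f (hA.eigenvalues i) := by
  rw [hA.cfc_eq, IsHermitian.cfc, Unitary.conjStarAlgAut_apply, trace_mul_cycle,
    Unitary.coe_star_mul_self, one_mul, trace_diagonal, Complex.re_sum]
  rfl

lemma re_trace_pow (hA : A.IsHermitian) (p : ℕ) :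
    ((A ^ p).trace).re = ∑ i, hA.eigenvalues i ^ p := by
  rw [← cfc_pow_id (R := ℝ) A p hA.isSelfAdjoint, hA.re_trace_cfc]

end Matrix.IsHermitian

/-- Truncation at level `c` only moves points with `c < |t|`, and by at most `|t|`. -/
lemma sq_sub_truncation_le {c : ℝ} (hc : 0 < c) (t : ℝ) (p : ℕ) :
    (t - max (-c) (min c t)) ^ 2 ≤ t ^ 2 * |t / c| ^ p := by
  by_cases ht : |t| ≤ c
  · obtain ⟨h1, h2⟩ := abs_le.mp ht
    rw [min_eq_right h2, max_eq_right h1, sub_self, zero_pow two_ne_zero]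
    positivity
  · have hone : 1 ≤ |t / c| ^ p := by
      refine one_le_pow₀ ?_
      rw [abs_div, abs_of_pos hc, one_le_div hc]
      exact (not_le.mp ht).le
    have hsq : (t - max (-c) (min c t)) ^ 2 ≤ t ^ 2 := by
      rcases lt_abs.mp (not_le.mp ht) with h | h
      · rw [min_eq_left h.le, max_eq_right (by linarith)]
        nlinarith
      · rw [min_eq_right (by linarith), max_eq_left (by linarith)]
        nlinarith
    exact hsq.trans (le_mul_of_one_le_right (sq_nonneg t) hone)

lemma norm2_sub_matTrunc_sq {k : ℕ} {ξ : Matrix (Fin k) (Fin k) ℂ} (hξ : ξ.IsHermitian) (c : ℝ) :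
    norm2 (ξ - matTrunc c hξ) ^ 2 =
      (∑ i, (hξ.eigenvalues i - max (-c) (min c (hξ.eigenvalues i))) ^ 2) / k := by
  have hsa : IsSelfAdjoint ξ := hξ
  have hsub : ξ - matTrunc c hξ = cfc (fun t : ℝ => t - max (-c) (min c t)) ξ := by
    rw [matTrunc, ← hξ.cfc_eq, cfc_sub (fun t : ℝ => t) (fun t : ℝ => max (-c) (min c t)) ξ,
      cfc_id' ℝ ξ]
  have hstar : (ξ - matTrunc c hξ)ᴴ = ξ - matTrunc c hξ := by
    rw [hsub]
    exact (cfc_predicate (p := IsSelfAdjoint) _ ξ).star_eq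
  have htrace : (((ξ - matTrunc c hξ)ᴴ * (ξ - matTrunc c hξ)).trace).re =
      ∑ i, (hξ.eigenvalues i - max (-c) (min c (hξ.eigenvalues i))) ^ 2 := by
    rw [hstar, ← sq, hsub, ← cfc_pow (fun t : ℝ => t - max (-c) (min c t)) 2 ξ,
      hξ.re_trace_cfc]
  rw [norm2, htrace, Real.sq_sqrt]
  exact div_nonneg (Finset.sum_nonneg fun _ _ => sq_nonneg _) k.cast_nonneg

/-- For a Hermitian `k × k` matrix `ξ` (`k ≥ 1`), `R ≥ 1`, `γ > 0`
and a positive even integer `m`, if `tr_k(ξ^m) ≤ R^m + γ` and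
`tr_k(ξ⁴) ≤ R⁴ + γ`, then
`|ξ − F_{R+γ}(ξ)|₂² ≤ (R⁴ + γ)^{1/2} · ((R^m + γ)/(R + γ)^m)^{1/2}`. -/
theorem stmt2 (k : ℕ) (hk : 1 ≤ k) (ξ : Matrix (Fin k) (Fin k) ℂ)
    (hξ : ξ.IsHermitian) (R γ : ℝ) (hR : 1 ≤ R) (hγ : 0 < γ)
    (m : ℕ) (hm : 0 < m) (hme : Even m)
    (h1 : ((ξ ^ m).trace).re / k ≤ R ^ m + γ)
    (h2 : ((ξ ^ 4).trace).re / k ≤ R ^ 4 + γ) :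
    norm2 (ξ - matTrunc (R + γ) hξ) ^ 2
      ≤ Real.sqrt (R ^ 4 + γ) * Real.sqrt ((R ^ m + γ) / (R + γ) ^ m) := by
  have hc : 0 < R + γ := by linarith
  obtain ⟨p, rfl⟩ := hme
  have hcs := Real.sum_mul_le_sqrt_mul_sqrt Finset.univ
    (fun i => hξ.eigenvalues i ^ 2) (fun i => |hξ.eigenvalues i / (R + γ)| ^ p)
  have hfour : ∑ i, (hξ.eigenvalues i ^ 2) ^ 2 = ((ξ ^ 4).trace).re := by
    rw [hξ.re_trace_pow]
    exact Finset.sum_congr rfl fun i _ => by ring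
  have hpow : ∑ i, (|hξ.eigenvalues i / (R + γ)| ^ p) ^ 2 =
      ((ξ ^ (p + p)).trace).re / (R + γ) ^ (p + p) := by
    rw [hξ.re_trace_pow, Finset.sum_div]
    refine Finset.sum_congr rfl fun i _ => ?_
    rw [← pow_mul, mul_comm, pow_mul, sq_abs, ← pow_mul, div_pow, two_mul]
  rw [hfour, hpow] at hcs
  have hk0 : (0 : ℝ) < k := by exact_mod_cast hk
  rw [norm2_sub_matTrunc_sq]
  calc (∑ i, (hξ.eigenvalues i - max (-(R + γ)) (min (R + γ) (hξ.eigenvalues i))) ^ 2) / k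
      ≤ (√((ξ ^ 4).trace).re * √(((ξ ^ (p + p)).trace).re / (R + γ) ^ (p + p))) / k := by
        gcongr
        exact (Finset.sum_le_sum fun i _ => sq_sub_truncation_le hc _ p).trans hcs
    _ = √(((ξ ^ 4).trace).re / k) * √(((ξ ^ (p + p)).trace).re / k / (R + γ) ^ (p + p)) := by
        rw [div_right_comm, Real.sqrt_div' _ hk0.le, Real.sqrt_div' _ hk0.le, div_mul_div_comm,
          Real.mul_self_sqrt hk0.le]
    _ ≤ √(R ^ 4 + γ) * √((R ^ (p + p) + γ) / (R + γ) ^ (p + p)) := by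
        gcongr
end
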